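/- arXiv:2312.13363 — 2 statements merged into one kernel-verified Lean document; each statement's English description precedes it below -/
import Mathlib

section
/- Let n ≥ 1 and let v, w : {1,…,n} → ℕ be the gauge and framing dimension vectors of a finite type A linear quiver, with the boundary convention v_0 = v_{n+1} = 0. Assume the anomaly cancellation condition holds: for every i ∈ {1,…,n}, w_i + v_{i−1} + v_{i+1} ≥ 2·v_i. Then there exists a node i ∈ {1,…,n} such that either (1) w_i ≥ v_i, or (2) w_i < v_i and there exists j ∈ {i−1, i+1} ∩ {1,…,n} with v_j ≤ v_i and w_i + v_j ≥ v_i. -/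
/-- For a finite type A linear quiver with gauge dimensions `v` and framing dimensions `w`
(boundary convention `v 0 = v (n+1) = 0`) satisfying the anomaly cancellation condition
`w i + v (i-1) + v (i+1) ≥ 2 * v i` for all `1 ≤ i ≤ n`, there exists a node `i` with
either `w i ≥ v i`, or `w i < v i` together with a neighbor `j ∈ {i-1, i+1} ∩ {1,…,n}`
such that `v j ≤ v i` and `w i + v j ≥ v i`. -/
theorem linear_quiver_reduction_node_exists
    (n : ℕ) (hn : 1 ≤ n) (v w : ℕ → ℕ)
    (hv0 : v 0 = 0) (hvn : v (n + 1) = 0)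
    (hanom : ∀ i, 1 ≤ i → i ≤ n → 2 * v i ≤ w i + v (i - 1) + v (i + 1)) :
    ∃ i, 1 ≤ i ∧ i ≤ n ∧
      (v i ≤ w i ∨
        (w i < v i ∧ ∃ j, (j = i - 1 ∨ j = i + 1) ∧ 1 ≤ j ∧ j ≤ n ∧
          v j ≤ v i ∧ v i ≤ w i + v j)) := by
  -- A node maximizing `v` works: both neighbors satisfy `v j ≤ v i`.
  obtain ⟨i, hi, hmax⟩ := Finset.exists_max_image (Finset.Icc 1 n) v ⟨1, by simpa using hn⟩
  obtain ⟨hi1, hin⟩ := Finset.mem_Icc.1 hi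
  have hle : ∀ j ≤ n + 1, v j ≤ v i := by
    intro j hj
    rcases Nat.eq_zero_or_pos j with rfl | hj0
    · simp [hv0]
    rcases hj.eq_or_lt with rfl | hjn
    · simp [hvn]
    · exact hmax j (Finset.mem_Icc.2 ⟨hj0, by omega⟩)
  have hpred := hle (i - 1) (by omega)
  have hsucc := hle (i + 1) (by omega)
  have hi2 := hanom i hi1 hin
  refine ⟨i, hi1, hin, ?_⟩
  rcases le_or_gt (v i) (w i) with hw | hw
  · exact Or.inl hw
  rcases hin.eq_or_lt with rfl | hlt
  · omega
  · exact Or.inr ⟨hw, i + 1, Or.inr rfl, by omega, hlt, hsucc, by omega⟩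
end

section
/- Let n ≥ 1 and let B be an n×n complex matrix with trace zero. Then there exist an n×(n−1) complex matrix β and an (n−1)×n complex matrix α such that β·α − (tr(β·α)/n)·1_n = B, where 1_n is the n×n identity matrix. -/
/-- A matrix of rank at most `r` over a field factors through `Fin r`. -/
theorem exists_eq_mul_of_rank_le {K m n : Type*} [Field K] [Fintype m] [Fintype n]
    [DecidableEq n] (A : Matrix m n K) {r : ℕ} (h : A.rank ≤ r) :
    ∃ (β : Matrix m (Fin r) K) (α : Matrix (Fin r) n K), β * α = A := by
  let e : (LinearMap.range A.mulVecLin) ≃ₗ[K] (Fin A.rank → K) :=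
    LinearEquiv.ofFinrankEq _ _ (Module.finrank_fin_fun K).symm
  let g : (Fin r → K) →ₗ[K] LinearMap.range A.mulVecLin :=
    e.symm.toLinearMap ∘ₗ LinearMap.funLeft K K (Fin.castLE h)
  have hg : Function.Surjective g :=
    e.symm.surjective.comp
      (LinearMap.funLeft_surjective_of_injective K K _ (Fin.castLE_injective h))
  obtain ⟨f, hf⟩ := g.exists_rightInverse_of_surjective (LinearMap.range_eq_top.2 hg)
  refine ⟨LinearMap.toMatrix' ((LinearMap.range A.mulVecLin).subtype ∘ₗ g),
    LinearMap.toMatrix' (f ∘ₗ A.mulVecLin.rangeRestrict), ?_⟩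
  rw [← LinearMap.toMatrix'_comp, LinearMap.comp_assoc, ← LinearMap.comp_assoc _ f g, hf,
    LinearMap.id_comp, LinearMap.subtype_comp_codRestrict, ← Matrix.toLin'_apply',
    LinearMap.toMatrix'_toLin']

/-- A square matrix of full rank over a field is invertible. -/
theorem isUnit_of_card_le_rank {K n : Type*} [Field K] [Fintype n] [DecidableEq n]
    {A : Matrix n n K} (h : Fintype.card n ≤ A.rank) : IsUnit A := by
  have htop : LinearMap.range A.mulVecLin = ⊤ := by
    refine Submodule.eq_top_of_finrank_eq ?_
    rw [Module.finrank_fintype_fun_eq_card]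
    exact le_antisymm A.rank_le_card_width h
  exact Matrix.mulVec_surjective_iff_isUnit.1 (LinearMap.range_eq_top.1 htop)

/-- Every traceless `n × n` complex matrix `B` is the traceless part of a product `β * α`
with `β : n × (n-1)` and `α : (n-1) × n`. -/
theorem traceless_part_of_rank_deficient_surjective
    (n : ℕ) (hn : 1 ≤ n) (B : Matrix (Fin n) (Fin n) ℂ) (hB : Matrix.trace B = 0) :
    ∃ (β : Matrix (Fin n) (Fin (n - 1)) ℂ) (α : Matrix (Fin (n - 1)) (Fin n) ℂ),
      β * α - (Matrix.trace (β * α) / (n : ℂ)) • (1 : Matrix (Fin n) (Fin n) ℂ) = B := by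
  have : Nonempty (Fin n) := ⟨⟨0, hn⟩⟩
  obtain ⟨μ, hμ⟩ := spectrum.nonempty_of_isAlgClosed_of_finiteDimensional ℂ B
  have hrank : (B - μ • (1 : Matrix (Fin n) (Fin n) ℂ)).rank ≤ n - 1 := by
    by_contra! hlt
    refine hμ ?_
    rw [spectrum.mem_resolventSet_iff, ← IsUnit.neg_iff, neg_sub, Algebra.algebraMap_eq_smul_one]
    exact isUnit_of_card_le_rank (by rw [Fintype.card_fin]; omega)
  obtain ⟨β, α, h⟩ := exists_eq_mul_of_rank_le _ hrank
  refine ⟨β, α, ?_⟩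
  have hn0 : (n : ℂ) ≠ 0 := by exact_mod_cast (by omega : n ≠ 0)
  have htr : Matrix.trace (β * α) / (n : ℂ) = -μ := by
    rw [h, Matrix.trace_sub, hB, Matrix.trace_smul, Matrix.trace_one, Fintype.card_fin,
      smul_eq_mul]
    field_simp
    ring
  rw [htr, h, neg_smul, sub_neg_eq_add, sub_add_cancel]
end
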